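/- arXiv:cond-mat/9605132 — 2 statements merged into one kernel-verified Lean document; each statement's English description precedes it below -/
import Mathlib

section
/- If the conductances are i.i.d. with finite mean, then for every fixed L, lim_{A→∞} E(W^OBC_{L,A})/A = lim_{A→∞} E(W^CBC_{L,A})/A; i.e., the per-width expected dissipations with open and closed boundary conditions have the same limit as the transverse size goes to infinity. -/
open Filter MeasureTheory Topology

noncomputable section

/-- A conductance field on `ℤ²`: for each site, the conductance of the link to
the right (`.1`, longitudinal) and of the link upwards (`.2`, transverse). -/
abbrev CField := (ℤ × ℤ) → ℝ × ℝ

/-- The field of conductances is nonnegative. -/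
def nonnegField (C : CField) : Prop := ∀ p, 0 ≤ (C p).1 ∧ 0 ≤ (C p).2

/-- Dirichlet energy (dissipation) of the potential `φ` on the rectangle with
`L` longitudinal links and `A` transverse sites (rows `0,…,A-1`). -/
def netEnergy (C : CField) (L A : ℕ) (φ : ℤ × ℤ → ℝ) : ℝ :=
  (∑ i ∈ Finset.range L, ∑ j ∈ Finset.range A,
    (φ ((i : ℤ), (j : ℤ)) - φ ((i : ℤ) + 1, (j : ℤ)))^2 * (C ((i : ℤ), (j : ℤ))).1) +
  (∑ i ∈ Finset.range (L+1), ∑ j ∈ Finset.range (A-1),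
    (φ ((i : ℤ), (j : ℤ)) - φ ((i : ℤ), (j : ℤ) + 1))^2 * (C ((i : ℤ), (j : ℤ))).2)

/-- Open boundary conditions: the potential is fixed only on the two transverse
ends, to `0` and `L v₀`. -/
def obcOK (L A : ℕ) (v₀ : ℝ) (φ : ℤ × ℤ → ℝ) : Prop :=
  ∀ j ∈ Finset.range A, φ (0, (j : ℤ)) = 0 ∧ φ ((L : ℤ), (j : ℤ)) = L * v₀

/-- Closed boundary conditions: the potential is fixed to `n₁ v₀` on the whole
boundary of the rectangle. -/
def cbcOK (L A : ℕ) (v₀ : ℝ) (φ : ℤ × ℤ → ℝ) : Prop :=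
  ∀ i ∈ Finset.range (L+1), ∀ j ∈ Finset.range A,
    (i = 0 ∨ i = L ∨ j = 0 ∨ j = A - 1) → φ ((i : ℤ), (j : ℤ)) = i * v₀

/-- Total dissipation with open boundary conditions: minimal Dirichlet energy. -/
def WOBC (C : CField) (v₀ : ℝ) (L A : ℕ) : ℝ :=
  ⨅ φ : {φ : ℤ × ℤ → ℝ // obcOK L A v₀ φ}, netEnergy C L A φ.1

/-- Total dissipation with closed boundary conditions: minimal Dirichlet energy. -/
def WCBC (C : CField) (v₀ : ℝ) (L A : ℕ) : ℝ :=
  ⨅ φ : {φ : ℤ × ℤ → ℝ // cbcOK L A v₀ φ}, netEnergy C L A φ.1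

/-- Translation of the conductance field by `k` in the longitudinal direction. -/
def shiftH (k : ℤ) (C : CField) : CField := fun p => C (p.1 + k, p.2)

/-- Translation of the conductance field by `k` in the transverse direction. -/
def shiftV (k : ℤ) (C : CField) : CField := fun p => C (p.1, p.2 + k)

lemma netEnergy_nonneg {C : CField} (hC : nonnegField C) (L A : ℕ) (φ : ℤ × ℤ → ℝ) :
    0 ≤ netEnergy C L A φ :=
  add_nonneg
    (Finset.sum_nonneg fun _ _ => Finset.sum_nonneg fun _ _ =>
      mul_nonneg (sq_nonneg _) (hC _).1)
    (Finset.sum_nonneg fun _ _ => Finset.sum_nonneg fun _ _ =>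
      mul_nonneg (sq_nonneg _) (hC _).2)

lemma bddBelow_netEnergy {C : CField} (hC : nonnegField C) (L A : ℕ)
    (P : (ℤ × ℤ → ℝ) → Prop) :
    BddBelow (Set.range fun φ : {φ : ℤ × ℤ → ℝ // P φ} => netEnergy C L A φ.1) :=
  ⟨0, by rintro _ ⟨φ, rfl⟩; exact netEnergy_nonneg hC L A φ.1⟩

lemma WCBC_le_netEnergy {C : CField} (hC : nonnegField C) {v₀ : ℝ} {L A : ℕ}
    {φ : ℤ × ℤ → ℝ} (hφ : cbcOK L A v₀ φ) : WCBC C v₀ L A ≤ netEnergy C L A φ :=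
  ciInf_le (bddBelow_netEnergy hC L A (cbcOK L A v₀)) ⟨φ, hφ⟩

lemma WOBC_le_netEnergy {C : CField} (hC : nonnegField C) {v₀ : ℝ} {L A : ℕ}
    {φ : ℤ × ℤ → ℝ} (hφ : obcOK L A v₀ φ) : WOBC C v₀ L A ≤ netEnergy C L A φ :=
  ciInf_le (bddBelow_netEnergy hC L A (obcOK L A v₀)) ⟨φ, hφ⟩

/-- The potential growing linearly in the longitudinal direction. -/
def linearPotential (v₀ : ℝ) : ℤ × ℤ → ℝ := fun p => p.1 * v₀

lemma cbcOK_linearPotential (L A : ℕ) (v₀ : ℝ) : cbcOK L A v₀ (linearPotential v₀) :=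
  fun i _ j _ _ => by simp [linearPotential]

lemma cbcOK.obcOK {L A : ℕ} {v₀ : ℝ} {φ : ℤ × ℤ → ℝ} (h : cbcOK L A v₀ φ) :
    obcOK L A v₀ φ := fun j hj =>
  ⟨by simpa using h 0 (by simp) j hj (by simp), by simpa using h L (by simp) j hj (by simp)⟩

lemma le_WCBC {C : CField} {v₀ : ℝ} {L A : ℕ} {a : ℝ}
    (h : ∀ φ, cbcOK L A v₀ φ → a ≤ netEnergy C L A φ) : a ≤ WCBC C v₀ L A :=
  haveI : Nonempty {φ // cbcOK L A v₀ φ} := ⟨⟨_, cbcOK_linearPotential L A v₀⟩⟩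
  le_ciInf fun φ => h φ.1 φ.2

lemma le_WOBC {C : CField} {v₀ : ℝ} {L A : ℕ} {a : ℝ}
    (h : ∀ φ, obcOK L A v₀ φ → a ≤ netEnergy C L A φ) : a ≤ WOBC C v₀ L A :=
  haveI : Nonempty {φ // obcOK L A v₀ φ} := ⟨⟨_, (cbcOK_linearPotential L A v₀).obcOK⟩⟩
  le_ciInf fun φ => h φ.1 φ.2

lemma WOBC_le_WCBC {C : CField} (hC : nonnegField C) (v₀ : ℝ) (L A : ℕ) :
    WOBC C v₀ L A ≤ WCBC C v₀ L A :=
  le_WCBC fun _ hφ => WOBC_le_netEnergy hC hφ.obcOK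

lemma WOBC_nonneg {C : CField} (hC : nonnegField C) (v₀ : ℝ) (L A : ℕ) : 0 ≤ WOBC C v₀ L A :=
  le_WOBC fun φ _ => netEnergy_nonneg hC L A φ

lemma WCBC_zero {C : CField} (hC : nonnegField C) (v₀ : ℝ) (L : ℕ) : WCBC C v₀ L 0 = 0 :=
  le_antisymm ((WCBC_le_netEnergy hC (cbcOK_linearPotential L 0 v₀)).trans (by simp [netEnergy]))
    (le_WCBC fun φ _ => netEnergy_nonneg hC L 0 φ)

lemma WCBC_le_sum {C : CField} (hC : nonnegField C) (v₀ : ℝ) (L A : ℕ) :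
    WCBC C v₀ L A ≤
      v₀ ^ 2 * ∑ i ∈ Finset.range L, ∑ j ∈ Finset.range A, (C ((i : ℤ), (j : ℤ))).1 := by
  refine (WCBC_le_netEnergy hC (cbcOK_linearPotential L A v₀)).trans (le_of_eq ?_)
  simp only [netEnergy, linearPotential, Finset.mul_sum, sub_self]
  simp only [ne_eq, OfNat.ofNat_ne_zero, not_false_eq_true, zero_pow, zero_mul,
    Finset.sum_const_zero, add_zero]
  refine Finset.sum_congr rfl fun i _ => Finset.sum_congr rfl fun j _ => ?_
  push_cast
  ring

lemma le_WCBC_one {C : CField} (hC : nonnegField C) (v₀ : ℝ) {L i : ℕ} (hi : i < L) :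
    v₀ ^ 2 * (C ((i : ℤ), 0)).1 ≤ WCBC C v₀ L 1 := by
  refine le_WCBC fun φ hφ => ?_
  have h1 : φ ((i : ℤ), 0) = i * v₀ := by
    simpa using hφ i (by simp; omega) 0 (by simp) (by simp)
  have h2 : φ ((i : ℤ) + 1, 0) = (i + 1) * v₀ := by
    simpa using hφ (i + 1) (by simp; omega) 0 (by simp) (by simp)
  have h3 := Finset.single_le_sum (s := Finset.range L)
    (f := fun i : ℕ => (φ ((i : ℤ), 0) - φ ((i : ℤ) + 1, 0)) ^ 2 * (C ((i : ℤ), 0)).1)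
    (fun i _ => mul_nonneg (sq_nonneg _) (hC _).1) (Finset.mem_range.2 hi)
  simp only [netEnergy, Finset.sum_range_one, Nat.cast_zero, Nat.sub_self, Finset.range_zero,
    Finset.sum_empty, Finset.sum_const_zero, add_zero]
  refine le_trans (le_of_eq ?_) h3
  simp only [h1, h2]
  ring

/-- The potential equal to `φ` on the rows below `m` and to a translate of `ψ` above. -/
def gluePotential (m : ℕ) (φ ψ : ℤ × ℤ → ℝ) : ℤ × ℤ → ℝ :=
  fun p => if p.2 < m then φ p else ψ (p.1, p.2 - m)

lemma gluePotential_below {m : ℕ} (φ ψ : ℤ × ℤ → ℝ) (i : ℤ) {j : ℤ} (h : j < m) :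
    gluePotential m φ ψ (i, j) = φ (i, j) := by simp [gluePotential, h]

lemma gluePotential_above {m : ℕ} (φ ψ : ℤ × ℤ → ℝ) (i : ℤ) {j : ℤ} (h : 0 ≤ j) :
    gluePotential m φ ψ (i, m + j) = ψ (i, j) := by simp [gluePotential, h]

lemma cbcOK_gluePotential {L m n : ℕ} {v₀ : ℝ} {φ ψ : ℤ × ℤ → ℝ}
    (hφ : cbcOK L m v₀ φ) (hψ : cbcOK L n v₀ ψ) :
    cbcOK L (m + n) v₀ (gluePotential m φ ψ) := by
  intro i hi j hj hb
  rw [Finset.mem_range] at hj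
  by_cases h : j < m
  · rw [gluePotential_below _ _ _ (by exact_mod_cast h)]
    exact hφ i hi j (by simpa using h) (by omega)
  · obtain ⟨k, rfl⟩ := Nat.exists_eq_add_of_le (not_lt.1 h)
    rw [Nat.cast_add, gluePotential_above _ _ _ (by positivity)]
    exact hψ i hi k (by simp; omega) (by omega)

lemma netEnergy_gluePotential {C : CField} {L m n : ℕ} {v₀ : ℝ} {φ ψ : ℤ × ℤ → ℝ}
    (hm : 0 < m) (hn : 0 < n) (hφ : cbcOK L m v₀ φ) (hψ : cbcOK L n v₀ ψ) :
    netEnergy C L (m + n) (gluePotential m φ ψ) =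
      netEnergy C L m φ + netEnergy (shiftV m C) L n ψ := by
  simp only [netEnergy]
  rw [add_add_add_comm, ← Finset.sum_add_distrib, ← Finset.sum_add_distrib]
  congr 1
  · refine Finset.sum_congr rfl fun i _ => ?_
    rw [Finset.sum_range_add]
    congr 1
    · refine Finset.sum_congr rfl fun j hj => ?_
      have hj' : (j : ℤ) < m := by exact_mod_cast Finset.mem_range.1 hj
      rw [gluePotential_below _ _ _ hj', gluePotential_below _ _ _ hj']
    · refine Finset.sum_congr rfl fun j _ => ?_
      rw [Nat.cast_add, gluePotential_above _ _ _ (by positivity),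
        gluePotential_above _ _ _ (by positivity)]
      simp [shiftV, add_comm]
  · refine Finset.sum_congr rfl fun i hi => ?_
    obtain ⟨m, rfl⟩ := Nat.exists_eq_succ_of_ne_zero hm.ne'
    obtain ⟨n, rfl⟩ := Nat.exists_eq_succ_of_ne_zero hn.ne'
    have e : m.succ + n.succ - 1 = m.succ + n := by omega
    rw [e, Finset.sum_range_add, Finset.sum_range_succ]
    have e1 : gluePotential m.succ φ ψ ((i : ℤ), (m : ℤ)) = i * v₀ := by
      rw [gluePotential_below _ _ _ (by push_cast; omega)]
      exact hφ i hi m (by simp) (by simp)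
    have e2 : gluePotential m.succ φ ψ ((i : ℤ), (m : ℤ) + 1) = i * v₀ := by
      have := gluePotential_above (m := m.succ) φ ψ i (le_refl 0)
      push_cast at this
      rw [add_zero] at this
      rw [this]
      exact_mod_cast hψ i hi 0 (by simp) (by simp)
    rw [e1, e2, sub_self, zero_pow two_ne_zero, zero_mul, add_zero]
    congr 1
    · refine Finset.sum_congr rfl fun j hj => ?_
      have hj' := Finset.mem_range.1 hj
      rw [gluePotential_below _ _ _ (by push_cast; omega),
        gluePotential_below _ _ _ (by push_cast; omega)]
    · refine Finset.sum_congr rfl fun j _ => ?_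
      rw [Nat.cast_add, add_assoc, gluePotential_above _ _ _ (by positivity),
        gluePotential_above _ _ _ (by positivity)]
      simp [shiftV, add_comm]

lemma nonnegField.shiftV {C : CField} (hC : nonnegField C) (k : ℤ) : nonnegField (shiftV k C) :=
  fun _ => hC _

lemma WCBC_add_le {C : CField} (hC : nonnegField C) (v₀ : ℝ) (L m n : ℕ) :
    WCBC C v₀ L (m + n) ≤ WCBC C v₀ L m + WCBC (shiftV m C) v₀ L n := by
  rcases Nat.eq_zero_or_pos m with rfl | hm
  · have : shiftV ((0 : ℕ) : ℤ) C = C := by funext p; simp [shiftV]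
    rw [this, WCBC_zero hC, zero_add, zero_add]
  rcases Nat.eq_zero_or_pos n with rfl | hn
  · simp [WCBC_zero (hC.shiftV _)]
  rw [← sub_le_iff_le_add]
  refine le_WCBC fun φ hφ => ?_
  rw [sub_le_iff_le_add, ← sub_le_iff_le_add']
  refine le_WCBC fun ψ hψ => ?_
  rw [sub_le_iff_le_add', ← netEnergy_gluePotential hm hn hφ hψ]
  exact WCBC_le_netEnergy hC (cbcOK_gluePotential hφ hψ)

/-- The potential obtained from `φ` by clamping to `[0, L v₀]` and imposing the linear potential
on the rows `0` and `A - 1`. -/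
def closePotential (L A : ℕ) (v₀ : ℝ) (φ : ℤ × ℤ → ℝ) : ℤ × ℤ → ℝ :=
  fun p => if p.2 = 0 ∨ p.2 + 1 = A then p.1 * v₀ else max (min (φ p) (L * v₀)) 0

lemma cbcOK_closePotential {L A : ℕ} {v₀ : ℝ} (hv₀ : 0 ≤ v₀) {φ : ℤ × ℤ → ℝ}
    (hφ : obcOK L A v₀ φ) : cbcOK L A v₀ (closePotential L A v₀ φ) := by
  intro i hi j hj hb
  have hv : 0 ≤ L * v₀ := by positivity
  unfold closePotential
  split_ifs with h
  · simp
  · rw [Finset.mem_range] at hj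
    have : i = 0 ∨ i = L := by
      dsimp only at h
      omega
    obtain rfl | rfl := this
    · simp [(hφ j (by simpa using hj)).1, hv]
    · simp [(hφ j (by simpa using hj)).2, hv]

lemma closePotential_mem_Icc {L A : ℕ} {v₀ : ℝ} (hv₀ : 0 ≤ v₀) (φ : ℤ × ℤ → ℝ) {i : ℕ}
    (hi : i ≤ L) (j : ℤ) : closePotential L A v₀ φ (i, j) ∈ Set.Icc 0 (L * v₀) := by
  have hv : 0 ≤ L * v₀ := by positivity
  unfold closePotential
  split_ifs with h
  · have : (i : ℝ) ≤ L := by exact_mod_cast hi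
    exact ⟨by simp; positivity, by simp; gcongr⟩
  · simp [hv]

lemma sq_clamp_sub_clamp_le (a x y : ℝ) :
    (max (min x a) 0 - max (min y a) 0) ^ 2 ≤ (x - y) ^ 2 := by
  rw [sq_le_sq]
  refine (abs_max_sub_max_le_abs _ _ _).trans ?_
  simpa using abs_min_sub_min_le_max x a y a

lemma WCBC_le_WOBC_add {C : CField} (hC : nonnegField C) {v₀ : ℝ} (hv₀ : 0 ≤ v₀) (L B : ℕ)
    {M : ℝ} (h₀ : ∀ i ∈ Finset.range (L + 1), (C ((i : ℤ), 0)).2 ≤ M)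
    (h₁ : ∀ i ∈ Finset.range (L + 1), (C ((i : ℤ), (B : ℤ))).2 ≤ M) (hM : 0 ≤ M) :
    WCBC C v₀ L (B + 2) ≤ WOBC C v₀ L (B + 2) +
      v₀ ^ 2 * ∑ i ∈ Finset.range L, ((C ((i : ℤ), 0)).1 + (C ((i : ℤ), ((B + 1 : ℕ) : ℤ))).1) +
      (L + 1) * (2 * ((L * v₀) ^ 2 * M)) := by
  rw [add_assoc, ← sub_le_iff_le_add]
  refine le_WOBC fun φ hφ => ?_
  rw [sub_le_iff_le_add]
  refine (WCBC_le_netEnergy hC (cbcOK_closePotential hv₀ hφ)).trans ?_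
  set χ := closePotential L (B + 2) v₀ φ with hχ
  have hχe : ∀ i j : ℤ, (j = 0 ∨ j = B + 1) → χ (i, j) = i * v₀ := fun i j h => by
    rw [hχ, closePotential, if_pos]
    push_cast
    omega
  have hχi : ∀ i j : ℤ, ¬ (j = 0 ∨ j = B + 1) → χ (i, j) = max (min (φ (i, j)) (L * v₀)) 0 :=
    fun i j h => by
      rw [hχ, closePotential, if_neg]
      push_cast
      omega
  simp only [netEnergy]
  rw [add_add_add_comm]
  refine add_le_add ?_ ?_
  · rw [Finset.mul_sum, ← Finset.sum_add_distrib]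
    refine Finset.sum_le_sum fun i _ => ?_
    have key : ∀ j ∈ Finset.range (B + 2),
        (χ ((i : ℤ), (j : ℤ)) - χ ((i : ℤ) + 1, (j : ℤ))) ^ 2 * (C ((i : ℤ), (j : ℤ))).1 ≤
        (φ ((i : ℤ), (j : ℤ)) - φ ((i : ℤ) + 1, (j : ℤ))) ^ 2 * (C ((i : ℤ), (j : ℤ))).1 +
          ((if j = 0 then v₀ ^ 2 * (C ((i : ℤ), (j : ℤ))).1 else 0) +
          (if j = B + 1 then v₀ ^ 2 * (C ((i : ℤ), (j : ℤ))).1 else 0)) := by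
      intro j _
      have hc := (hC ((i : ℤ), (j : ℤ))).1
      have hp : 0 ≤ v₀ ^ 2 * (C ((i : ℤ), (j : ℤ))).1 := by positivity
      by_cases h : j = 0 ∨ j = B + 1
      · have h' : (j : ℤ) = 0 ∨ (j : ℤ) = B + 1 := by omega
        rw [hχe _ _ h', hχe _ _ h']
        have e : (((i : ℤ) : ℝ) * v₀ - (((i : ℤ) + 1 : ℤ) : ℝ) * v₀) ^ 2 = v₀ ^ 2 := by
          push_cast
          ring
        rw [e]
        refine le_add_of_nonneg_of_le (by positivity) ?_
        split_ifs <;> first | omega | linarith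
      · have h' : ¬ ((j : ℤ) = 0 ∨ (j : ℤ) = B + 1) := by omega
        rw [hχi _ _ h', hχi _ _ h']
        refine le_add_of_le_of_nonneg ?_ (by positivity)
        gcongr ?_ * _
        exact sq_clamp_sub_clamp_le _ _ _
    refine (Finset.sum_le_sum key).trans (le_of_eq ?_)
    rw [Finset.sum_add_distrib, Finset.sum_add_distrib, Finset.sum_ite_eq', Finset.sum_ite_eq']
    simp [mul_add]
  · have hcard : ((L : ℝ) + 1) * (2 * ((L * v₀) ^ 2 * M)) =
        ∑ i ∈ Finset.range (L + 1), 2 * ((L * v₀) ^ 2 * M) := by simp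
    rw [hcard, ← Finset.sum_add_distrib]
    refine Finset.sum_le_sum fun i hi => ?_
    have e : B + 2 - 1 = B + 1 := rfl
    rw [e]
    have key : ∀ j ∈ Finset.range (B + 1),
        (χ ((i : ℤ), (j : ℤ)) - χ ((i : ℤ), (j : ℤ) + 1)) ^ 2 * (C ((i : ℤ), (j : ℤ))).2 ≤
        (φ ((i : ℤ), (j : ℤ)) - φ ((i : ℤ), (j : ℤ) + 1)) ^ 2 * (C ((i : ℤ), (j : ℤ))).2 +
          ((if j = 0 then (L * v₀) ^ 2 * M else 0) +
          (if j = B then (L * v₀) ^ 2 * M else 0)) := by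
      intro j hj
      rw [Finset.mem_range] at hj
      have hc := (hC ((i : ℤ), (j : ℤ))).2
      have hp : 0 ≤ (L * v₀) ^ 2 * M := by positivity
      by_cases h : j = 0 ∨ j = B
      · have hCM : (C ((i : ℤ), (j : ℤ))).2 ≤ M := by
          obtain rfl | rfl := h
          · exact h₀ i hi
          · exact h₁ i hi
        have hiL : i ≤ L := by simpa [Nat.lt_succ_iff] using hi
        obtain ⟨a₁, b₁⟩ := closePotential_mem_Icc (A := B + 2) hv₀ φ hiL j
        obtain ⟨a₂, b₂⟩ := closePotential_mem_Icc (A := B + 2) hv₀ φ hiL (j + 1)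
        rw [← hχ] at a₁ b₁ a₂ b₂
        have hsq : (χ ((i : ℤ), (j : ℤ)) - χ ((i : ℤ), (j : ℤ) + 1)) ^ 2 ≤ (L * v₀) ^ 2 :=
          sq_le_sq' (by linarith) (by linarith)
        have : (χ ((i : ℤ), (j : ℤ)) - χ ((i : ℤ), (j : ℤ) + 1)) ^ 2 * (C ((i : ℤ), (j : ℤ))).2
            ≤ (L * v₀) ^ 2 * M := by gcongr
        refine le_add_of_nonneg_of_le (by positivity) ?_
        split_ifs <;> first | omega | linarith
      · have h' : ¬ ((j : ℤ) = 0 ∨ (j : ℤ) = B + 1) := by omega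
        have h'' : ¬ ((j : ℤ) + 1 = 0 ∨ (j : ℤ) + 1 = B + 1) := by omega
        rw [hχi _ _ h', hχi _ _ h'']
        refine le_add_of_le_of_nonneg ?_ (by positivity)
        gcongr ?_ * _
        exact sq_clamp_sub_clamp_le _ _ _
    refine (Finset.sum_le_sum key).trans (le_of_eq ?_)
    rw [Finset.sum_add_distrib, Finset.sum_add_distrib, Finset.sum_ite_eq', Finset.sum_ite_eq']
    simp [two_mul]

lemma measurePreserving_shiftV {μ : Measure CField} (h : MeasurePreserving (shiftV 1) μ μ)
    (n : ℕ) : MeasurePreserving (shiftV n) μ μ := by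
  induction n with
  | zero =>
    have : shiftV ((0 : ℕ) : ℤ) = id := by funext C p; simp [shiftV]
    exact this ▸ MeasurePreserving.id μ
  | succ n ih =>
    have : shiftV ((n + 1 : ℕ) : ℤ) = shiftV 1 ∘ shiftV n := by
      funext C p
      simp only [shiftV, Function.comp_apply, Nat.cast_succ, add_assoc, add_comm (1 : ℤ)]
    exact this ▸ h.comp ih

lemma integral_comp_measurePreserving {α : Type*} [MeasurableSpace α] {μ : Measure α} {T : α → α}
    (hT : MeasurePreserving T μ μ) {f : α → ℝ} (hf : AEStronglyMeasurable f μ) :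
    ∫ x, f (T x) ∂μ = ∫ x, f x ∂μ := by
  have := integral_map hT.measurable.aemeasurable (hT.map_eq.symm ▸ hf)
  rw [hT.map_eq] at this
  exact this.symm

lemma tendsto_integral_max_sub_natCast {α : Type*} [MeasurableSpace α] {μ : Measure α}
    {X : α → ℝ} (hX : Integrable X μ) :
    Tendsto (fun n : ℕ => ∫ x, max (X x - n) 0 ∂μ) atTop (𝓝 0) := by
  have := tendsto_integral_of_dominated_convergence (μ := μ)
    (F := fun (n : ℕ) x => max (X x - n) 0) (f := fun _ => 0) (fun x => |X x|)
    (fun n => (hX.1.sub aestronglyMeasurable_const).sup aestronglyMeasurable_const) hX.abs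
    (fun n => Eventually.of_forall fun x => by
      rw [Real.norm_of_nonneg (le_max_right _ _)]
      have : (0 : ℝ) ≤ n := n.cast_nonneg
      exact max_le (by linarith [le_abs_self (X x)]) (abs_nonneg _))
    (Eventually.of_forall fun x => by
      refine tendsto_const_nhds.congr' ?_
      filter_upwards [eventually_ge_atTop ⌈X x⌉₊] with n hn
      rw [max_eq_right (sub_nonpos.2 (Nat.ceil_le.1 hn))])
  simpa using this

/-- The indicator function of the half-line `(M, ∞)`. -/
def tailIndicator (M x : ℝ) : ℝ := if M < x then 1 else 0

lemma tailIndicator_nonneg (M x : ℝ) : 0 ≤ tailIndicator M x := by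
  unfold tailIndicator; split_ifs <;> norm_num

lemma tailIndicator_le_one (M x : ℝ) : tailIndicator M x ≤ 1 := by
  unfold tailIndicator; split_ifs <;> norm_num

lemma measurable_tailIndicator (M : ℝ) : Measurable (tailIndicator M) :=
  Measurable.ite measurableSet_Ioi measurable_const measurable_const

lemma integrable_tailIndicator {α : Type*} [MeasurableSpace α] {μ : Measure α}
    [IsFiniteMeasure μ] {X : α → ℝ} (hX : Measurable X) (M : ℝ) :
    Integrable (fun x => tailIndicator M (X x)) μ :=
  (integrable_const (1 : ℝ)).mono' ((measurable_tailIndicator M).comp hX).aestronglyMeasurable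
    (Eventually.of_forall fun x => by
      rw [Real.norm_of_nonneg (tailIndicator_nonneg _ _)]
      exact tailIndicator_le_one _ _)

lemma tendsto_integral_tailIndicator {α : Type*} [MeasurableSpace α] {μ : Measure α}
    [IsFiniteMeasure μ] {X : α → ℝ} (hX : Measurable X) :
    Tendsto (fun n : ℕ => ∫ x, tailIndicator n (X x) ∂μ) atTop (𝓝 0) := by
  have := tendsto_integral_of_dominated_convergence (μ := μ)
    (F := fun (n : ℕ) x => tailIndicator n (X x)) (f := fun _ => 0) (fun _ => 1)
    (fun n => ((measurable_tailIndicator n).comp hX).aestronglyMeasurable) (integrable_const _)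
    (fun n => Eventually.of_forall fun x => by
      rw [Real.norm_of_nonneg (tailIndicator_nonneg _ _)]
      exact tailIndicator_le_one _ _)
    (Eventually.of_forall fun x => by
      refine tendsto_const_nhds.congr' ?_
      filter_upwards [eventually_ge_atTop ⌈X x⌉₊] with n hn
      rw [tailIndicator, if_neg (not_lt.2 (Nat.ceil_le.1 hn))])
  simpa using this

lemma WCBC_le_WOBC_add_tail {C : CField} (hC : nonnegField C) {v₀ : ℝ} (hv₀ : 0 ≤ v₀) (L B : ℕ)
    {R M : ℝ} (hR : 0 ≤ R) (hM : 0 ≤ M) :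
    WCBC C v₀ L (B + 2) ≤ WOBC C v₀ L (B + 2) +
      v₀ ^ 2 * ∑ i ∈ Finset.range L, ((C ((i : ℤ), 0)).1 + (C ((i : ℤ), ((B + 1 : ℕ) : ℤ))).1) +
      (L + 1) * (2 * ((L * v₀) ^ 2 * M)) +
      v₀ ^ 2 * ∑ i ∈ Finset.range L, ∑ j ∈ Finset.range (B + 2),
        (max ((C ((i : ℤ), (j : ℤ))).1 - R) 0 +
          R * ∑ k ∈ Finset.range (L + 1),
            (tailIndicator M (C ((k : ℤ), 0)).2 + tailIndicator M (C ((k : ℤ), (B : ℤ))).2)) := by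
  set D := ∑ k ∈ Finset.range (L + 1),
    (tailIndicator M (C ((k : ℤ), 0)).2 + tailIndicator M (C ((k : ℤ), (B : ℤ))).2) with hD
  have hterm : ∀ k ∈ Finset.range (L + 1), 0 ≤
      tailIndicator M (C ((k : ℤ), 0)).2 + tailIndicator M (C ((k : ℤ), (B : ℤ))).2 :=
    fun k _ => add_nonneg (tailIndicator_nonneg _ _) (tailIndicator_nonneg _ _)
  have hD0 : 0 ≤ D := Finset.sum_nonneg hterm
  by_cases h : ∀ k ∈ Finset.range (L + 1), (C ((k : ℤ), 0)).2 ≤ M ∧ (C ((k : ℤ), (B : ℤ))).2 ≤ M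
  · refine (WCBC_le_WOBC_add hC hv₀ L B (fun k hk => (h k hk).1) (fun k hk => (h k hk).2)
      hM).trans (le_add_of_nonneg_right ?_)
    exact mul_nonneg (sq_nonneg _) (Finset.sum_nonneg fun i _ => Finset.sum_nonneg fun j _ =>
      add_nonneg (le_max_right _ _) (mul_nonneg hR hD0))
  · push Not at h
    obtain ⟨k, hk, hkM⟩ := h
    have hD1 : 1 ≤ D := by
      refine le_trans ?_ (Finset.single_le_sum hterm hk)
      by_cases h0 : (C ((k : ℤ), 0)).2 ≤ M
      · refine le_add_of_nonneg_of_le (tailIndicator_nonneg _ _) ?_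
        rw [tailIndicator, if_pos (hkM h0)]
      · refine le_add_of_le_of_nonneg ?_ (tailIndicator_nonneg _ _)
        rw [tailIndicator, if_pos (not_le.1 h0)]
    refine (WCBC_le_sum hC v₀ L (B + 2)).trans (le_add_of_nonneg_of_le ?_ ?_)
    · have h1 := WOBC_nonneg hC v₀ L (B + 2)
      have h2 : 0 ≤ ∑ i ∈ Finset.range L,
          ((C ((i : ℤ), 0)).1 + (C ((i : ℤ), ((B + 1 : ℕ) : ℤ))).1) :=
        Finset.sum_nonneg fun i _ => add_nonneg (hC _).1 (hC _).1
      positivity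
    · gcongr with i _ j _
      have h1 := le_max_left ((C ((i : ℤ), (j : ℤ))).1 - R) 0
      have h2 := le_mul_of_one_le_right hR hD1
      linarith

lemma integral_comp_apply_eq {μ : Measure CField} (hstat : MeasurePreserving (shiftV 1) μ μ)
    {g : ℝ × ℝ → ℝ} (hg : Measurable g) (i : ℤ) (j : ℕ) :
    ∫ C, g (C (i, (j : ℤ))) ∂μ = ∫ C, g (C (i, 0)) ∂μ := by
  have := integral_comp_measurePreserving (measurePreserving_shiftV hstat j)
    (f := fun C : CField => g (C (i, 0)))
    (hg.comp (measurable_pi_apply _)).aestronglyMeasurable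
  simpa [shiftV] using this

lemma integrable_comp_apply {μ : Measure CField} (hstat : MeasurePreserving (shiftV 1) μ μ)
    {g : ℝ × ℝ → ℝ} {i : ℤ} (h : Integrable (fun C : CField => g (C (i, 0))) μ) (j : ℕ) :
    Integrable (fun C : CField => g (C (i, (j : ℤ)))) μ := by
  have := (measurePreserving_shiftV hstat j).integrable_comp_of_integrable h
  simpa [shiftV, Function.comp_def] using this

lemma integrable_longitudinal {μ : Measure CField} (hnn : ∀ᵐ C ∂μ, nonnegField C) {v₀ : ℝ}
    (hv₀ : 0 < v₀) {L i : ℕ} (hi : i < L) (h : Integrable (fun C => WCBC C v₀ L 1) μ) :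
    Integrable (fun C : CField => (C ((i : ℤ), 0)).1) μ := by
  refine (h.div_const (v₀ ^ 2)).mono'
    (measurable_fst.comp (measurable_pi_apply _)).aestronglyMeasurable ?_
  filter_upwards [hnn] with C hC
  rw [Real.norm_of_nonneg (hC _).1, le_div_iff₀ (by positivity), mul_comm]
  exact le_WCBC_one hC v₀ hi

lemma integral_WCBC_le {μ : Measure CField} [IsProbabilityMeasure μ]
    (hstat : MeasurePreserving (shiftV 1) μ μ) (hnn : ∀ᵐ C ∂μ, nonnegField C)
    {v₀ : ℝ} (hv₀ : 0 < v₀) {L : ℕ} (hintO : ∀ A, Integrable (fun C => WOBC C v₀ L A) μ)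
    (hintC : ∀ A, Integrable (fun C => WCBC C v₀ L A) μ) {R M : ℝ} (hR : 0 ≤ R) (hM : 0 ≤ M)
    (B : ℕ) :
    ∫ C, WCBC C v₀ L (B + 2) ∂μ ≤ ∫ C, WOBC C v₀ L (B + 2) ∂μ +
      (v₀ ^ 2 * ∑ i ∈ Finset.range L, 2 * ∫ C, (C ((i : ℤ), 0)).1 ∂μ +
        (L + 1) * (2 * ((L * v₀) ^ 2 * M))) +
      ((B + 2 : ℕ) : ℝ) * (v₀ ^ 2 * ∑ i ∈ Finset.range L,
        (∫ C, max ((C ((i : ℤ), 0)).1 - R) 0 ∂μ +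
          R * ∑ k ∈ Finset.range (L + 1), 2 * ∫ C, tailIndicator M (C ((k : ℤ), 0)).2 ∂μ)) := by
  have hX : ∀ i ∈ Finset.range L, ∀ j : ℕ,
      Integrable (fun C : CField => (C ((i : ℤ), (j : ℤ))).1) μ := fun i hi =>
    integrable_comp_apply hstat (g := Prod.fst)
      (integrable_longitudinal hnn hv₀ (Finset.mem_range.1 hi) (hintC 1))
  have hXm : ∀ i ∈ Finset.range L, ∀ j : ℕ,
      Integrable (fun C : CField => max ((C ((i : ℤ), (j : ℤ))).1 - R) 0) μ := fun i hi j =>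
    ((hX i hi j).sub (integrable_const R)).pos_part
  have hT : ∀ k j : ℕ, Integrable (fun C : CField => tailIndicator M (C ((k : ℤ), (j : ℤ))).2) μ :=
    fun k j => integrable_tailIndicator (measurable_snd.comp (measurable_pi_apply _)) M
  have eX : ∀ i j : ℕ, ∫ C, (C ((i : ℤ), (j : ℤ))).1 ∂μ = ∫ C, (C ((i : ℤ), 0)).1 ∂μ :=
    fun i j => integral_comp_apply_eq hstat measurable_fst i j
  have eXm : ∀ i j : ℕ, ∫ C, max ((C ((i : ℤ), (j : ℤ))).1 - R) 0 ∂μ =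
      ∫ C, max ((C ((i : ℤ), 0)).1 - R) 0 ∂μ :=
    fun i j => integral_comp_apply_eq hstat
      (g := fun p => max (p.1 - R) 0) ((measurable_fst.sub_const R).max measurable_const) i j
  have eT : ∀ k j : ℕ, ∫ C, tailIndicator M (C ((k : ℤ), (j : ℤ))).2 ∂μ =
      ∫ C, tailIndicator M (C ((k : ℤ), 0)).2 ∂μ :=
    fun k j => integral_comp_apply_eq hstat
      (g := fun p => tailIndicator M p.2) ((measurable_tailIndicator M).comp measurable_snd) k j
  have iX : ∀ i ∈ Finset.range L, Integrable (fun C : CField =>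
      (C ((i : ℤ), ((0 : ℕ) : ℤ))).1 + (C ((i : ℤ), ((B + 1 : ℕ) : ℤ))).1) μ :=
    fun i hi => (hX i hi 0).add (hX i hi (B + 1))
  have iT : ∀ k ∈ Finset.range (L + 1), Integrable (fun C : CField =>
      tailIndicator M (C ((k : ℤ), ((0 : ℕ) : ℤ))).2 +
        tailIndicator M (C ((k : ℤ), (B : ℤ))).2) μ :=
    fun k _ => (hT k 0).add (hT k B)
  have iD := (integrable_finsetSum _ iT).const_mul R
  have iS : ∀ i ∈ Finset.range L, ∀ j ∈ Finset.range (B + 2), Integrable (fun C : CField =>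
      max ((C ((i : ℤ), (j : ℤ))).1 - R) 0 + R * ∑ k ∈ Finset.range (L + 1),
        (tailIndicator M (C ((k : ℤ), ((0 : ℕ) : ℤ))).2 +
          tailIndicator M (C ((k : ℤ), (B : ℤ))).2)) μ :=
    fun i hi j _ => (hXm i hi j).add iD
  have iSS := fun i hi => integrable_finsetSum _ (iS i hi)
  have i1 := (integrable_finsetSum _ iX).const_mul (v₀ ^ 2)
  have i2 := (integrable_finsetSum _ iSS).const_mul (v₀ ^ 2)
  have i3 := (hintO (B + 2)).add i1
  have i4 := i3.add (integrable_const (μ := μ) (((L : ℝ) + 1) * (2 * ((L * v₀) ^ 2 * M))))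
  refine (integral_mono_ae (hintC (B + 2)) (i4.add i2) ?_).trans (le_of_eq ?_)
  · filter_upwards [hnn] with C hC
    exact_mod_cast WCBC_le_WOBC_add_tail hC hv₀.le L B hR hM
  · have e1 : ∫ C, (v₀ ^ 2 * ∑ i ∈ Finset.range L,
        ((C ((i : ℤ), ((0 : ℕ) : ℤ))).1 + (C ((i : ℤ), ((B + 1 : ℕ) : ℤ))).1)) ∂μ =
        v₀ ^ 2 * ∑ i ∈ Finset.range L, 2 * ∫ C, (C ((i : ℤ), 0)).1 ∂μ := by
      rw [integral_const_mul, integral_finsetSum _ iX]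
      congr 1
      refine Finset.sum_congr rfl fun i hi => ?_
      rw [integral_add (hX i hi 0) (hX i hi (B + 1)), eX, eX, two_mul]
    have eD : ∫ C, (R * ∑ k ∈ Finset.range (L + 1),
        (tailIndicator M (C ((k : ℤ), ((0 : ℕ) : ℤ))).2 +
          tailIndicator M (C ((k : ℤ), (B : ℤ))).2)) ∂μ =
        R * ∑ k ∈ Finset.range (L + 1), 2 * ∫ C, tailIndicator M (C ((k : ℤ), 0)).2 ∂μ := by
      rw [integral_const_mul, integral_finsetSum _ iT]
      congr 1
      refine Finset.sum_congr rfl fun k _ => ?_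
      rw [integral_add (hT k 0) (hT k B), eT, eT, two_mul]
    rw [integral_add' i4 i2, integral_add' i3 (integrable_const _), integral_add' (hintO _) i1, e1,
      integral_const, integral_const_mul, integral_finsetSum _ iSS]
    have e2 : ∀ i ∈ Finset.range L, ∫ C, (∑ j ∈ Finset.range (B + 2),
        (max ((C ((i : ℤ), (j : ℤ))).1 - R) 0 + R * ∑ k ∈ Finset.range (L + 1),
          (tailIndicator M (C ((k : ℤ), ((0 : ℕ) : ℤ))).2 +
            tailIndicator M (C ((k : ℤ), (B : ℤ))).2))) ∂μ =
        ((B + 2 : ℕ) : ℝ) * (∫ C, max ((C ((i : ℤ), 0)).1 - R) 0 ∂μ +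
          R * ∑ k ∈ Finset.range (L + 1), 2 * ∫ C, tailIndicator M (C ((k : ℤ), 0)).2 ∂μ) := by
      intro i hi
      rw [integral_finsetSum _ (iS i hi), Finset.sum_congr rfl fun j _ =>
        (integral_add (hXm i hi j) iD).trans (congrArg₂ _ (eXm i j) eD)]
      rw [Finset.sum_const, Finset.card_range, nsmul_eq_mul]
    rw [Finset.sum_congr rfl e2, ← Finset.mul_sum _ _ ((B + 2 : ℕ) : ℝ)]
    simp only [probReal_univ, one_smul]
    ring

/-- **Boundary-condition independence of the per-width expected dissipation.**
If the conductances are nonnegative, identically distributed under the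
transverse shift, and of finite mean, then for every fixed `L` the limits
`lim_{A→∞} E(W^OBC_{L,A})/A` and `lim_{A→∞} E(W^CBC_{L,A})/A` exist and are
equal. -/
theorem expected_dissipation_BC_independent
    (μ : Measure CField) [IsProbabilityMeasure μ]
    (hstat : MeasurePreserving (shiftV 1) μ μ)
    (hnn : ∀ᵐ C ∂μ, nonnegField C)
    (hmean₁ : Integrable (fun C : CField => (C 0).1) μ)
    (hmean₂ : Integrable (fun C : CField => (C 0).2) μ)
    (v₀ : ℝ) (hv₀ : 0 < v₀) (L : ℕ) (hL : 1 ≤ L)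
    (hintO : ∀ A, Integrable (fun C => WOBC C v₀ L A) μ)
    (hintC : ∀ A, Integrable (fun C => WCBC C v₀ L A) μ) :
    ∃ ℓ : ℝ,
      Tendsto (fun A : ℕ => (∫ C, WOBC C v₀ L A ∂μ) / A) atTop (𝓝 ℓ) ∧
      Tendsto (fun A : ℕ => (∫ C, WCBC C v₀ L A ∂μ) / A) atTop (𝓝 ℓ) := by
  set u : ℕ → ℝ := fun A => ∫ C, WCBC C v₀ L A ∂μ with hu
  set o : ℕ → ℝ := fun A => ∫ C, WOBC C v₀ L A ∂μ with ho
  have hou : ∀ A, o A ≤ u A := fun A => integral_mono_ae (hintO A) (hintC A) <| by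
    filter_upwards [hnn] with C hC using WOBC_le_WCBC hC v₀ L A
  have ho0 : ∀ A, 0 ≤ o A := fun A => integral_nonneg_of_ae <| by
    filter_upwards [hnn] with C hC using WOBC_nonneg hC v₀ L A
  have hsub : Subadditive u := by
    intro m n
    have hm := measurePreserving_shiftV hstat m
    have hi : Integrable (fun C => WCBC (shiftV m C) v₀ L n) μ :=
      hm.integrable_comp_of_integrable (hintC n)
    calc u (m + n) ≤ ∫ C, (WCBC C v₀ L m + WCBC (shiftV m C) v₀ L n) ∂μ :=
          integral_mono_ae (hintC _) ((hintC m).add hi) <| by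
            filter_upwards [hnn] with C hC using WCBC_add_le hC v₀ L m n
      _ = u m + u n := by
          rw [integral_add (hintC m) hi, integral_comp_measurePreserving hm (hintC n).1]
  have hlim : Tendsto (fun A : ℕ => u A / A) atTop (𝓝 hsub.lim) :=
    hsub.tendsto_lim ⟨0, by
      rintro _ ⟨A, rfl⟩
      exact div_nonneg ((ho0 A).trans (hou A)) A.cast_nonneg⟩
  have hdiff : Tendsto (fun A : ℕ => u A / A - o A / A) atTop (𝓝 0) := by
    refine tendsto_order.2 ⟨fun a ha => Eventually.of_forall fun A => ha.trans_le ?_,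
      fun ε hε => ?_⟩
    · rw [← sub_div]
      exact div_nonneg (sub_nonneg.2 (hou A)) A.cast_nonneg
    have hTM : Tendsto (fun M : ℕ => ∑ k ∈ Finset.range (L + 1),
        2 * ∫ C, tailIndicator M (C ((k : ℤ), 0)).2 ∂μ) atTop (𝓝 0) := by
      simpa using tendsto_finsetSum (Finset.range (L + 1)) fun k _ =>
        (tendsto_integral_tailIndicator (μ := μ) (X := fun C : CField => (C ((k : ℤ), 0)).2)
          (measurable_snd.comp (measurable_pi_apply _))).const_mul 2
    have hTR : Tendsto (fun R : ℕ => v₀ ^ 2 * ∑ i ∈ Finset.range L,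
        ∫ C, max ((C ((i : ℤ), 0)).1 - R) 0 ∂μ) atTop (𝓝 0) := by
      simpa using (tendsto_finsetSum (Finset.range L) fun i hi =>
        tendsto_integral_max_sub_natCast (integrable_longitudinal hnn hv₀
          (Finset.mem_range.1 hi) (hintC 1))).const_mul (v₀ ^ 2)
    obtain ⟨R, hR⟩ := (hTR.eventually_lt_const (half_pos hε)).exists
    have hTδ : Tendsto (fun M : ℕ => v₀ ^ 2 * ∑ i ∈ Finset.range L,
        (∫ C, max ((C ((i : ℤ), 0)).1 - R) 0 ∂μ + R * ∑ k ∈ Finset.range (L + 1),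
          2 * ∫ C, tailIndicator M (C ((k : ℤ), 0)).2 ∂μ)) atTop
        (𝓝 (v₀ ^ 2 * ∑ i ∈ Finset.range L, ∫ C, max ((C ((i : ℤ), 0)).1 - R) 0 ∂μ)) := by
      simpa using (tendsto_finsetSum (Finset.range L) fun i _ =>
        (hTM.const_mul (R : ℝ)).const_add
          (∫ C, max ((C ((i : ℤ), 0)).1 - R) 0 ∂μ)).const_mul (v₀ ^ 2)
    obtain ⟨M, hM⟩ := (hTδ.eventually_lt_const hR).exists
    have hbound := integral_WCBC_le hstat hnn hv₀ hintO hintC (R := R) (M := M)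
      R.cast_nonneg M.cast_nonneg
    set δ := v₀ ^ 2 * ∑ i ∈ Finset.range L,
        (∫ C, max ((C ((i : ℤ), 0)).1 - R) 0 ∂μ + R * ∑ k ∈ Finset.range (L + 1),
          2 * ∫ C, tailIndicator M (C ((k : ℤ), 0)).2 ∂μ)
    set K := v₀ ^ 2 * ∑ i ∈ Finset.range L, 2 * ∫ C, (C ((i : ℤ), 0)).1 ∂μ +
        (L + 1) * (2 * ((L * v₀) ^ 2 * M))
    filter_upwards [eventually_ge_atTop 2,
      (tendsto_const_div_atTop_nhds_zero_nat K).eventually_lt_const (half_pos hε)] with A hA hKA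
    obtain ⟨B, rfl⟩ := Nat.exists_eq_add_of_le' hA
    have hpos : (0 : ℝ) < ((B + 2 : ℕ) : ℝ) := by positivity
    have hle : (u (B + 2) - o (B + 2)) / ((B + 2 : ℕ) : ℝ) ≤ K / ((B + 2 : ℕ) : ℝ) + δ := by
      rw [div_add' _ _ _ hpos.ne']
      gcongr
      linarith [hbound B]
    rw [← sub_div]
    linarith
  exact ⟨hsub.lim, by simpa using hlim.sub hdiff, hlim⟩
end
end

section
/- Let (ξ_n) be a superadditive process with respect to an i.i.d. shift τ (i.e., ξ_{m+n} ≥ ξ_m + ξ_n ∘ τ^m with the shifted pieces independent and identically distributed), with E(ξ_n) ≤ A n. Then ξ_n/n converges almost surely and in the mean to the constant γ = sup_n E(ξ_n)/n. -/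
open Filter MeasureTheory Topology

/-- A sequence of integrable functions vanishing at index `0` which is almost everywhere
superadditive along the orbits of `τ`. -/
structure IsSuperadditiveProcess {Ω : Type*} [MeasurableSpace Ω] (μ : Measure Ω)
    (τ : Ω → Ω) (ξ : ℕ → Ω → ℝ) : Prop where
  zero : ∀ ω, ξ 0 ω = 0
  integrable : ∀ n, Integrable (ξ n) μ
  superadd : ∀ m n, ∀ᵐ ω ∂μ, ξ m ω + ξ n (τ^[m] ω) ≤ ξ (m + n) ω

/-- A lower bound for a superadditive array: every starting point `k` is either charged the cost
`a j k` or begins a block on which the array is nonnegative. -/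
theorem neg_sum_cost_le_of_superadditive {x a : ℕ → ℕ → ℝ} (h0 : ∀ k, x 0 k = 0)
    (hx : ∀ k m n, x m k + x n (m + k) ≤ x (m + n) k) (ha : ∀ j k, 0 ≤ a j k)
    (hcost : ∀ j k, 1 ≤ j → |x 1 k| ≤ a j k ∨ ∃ n, 1 ≤ n ∧ n ≤ j ∧ 0 ≤ x n k) (L k : ℕ) :
    -∑ i ∈ Finset.range L, a (L - i) (i + k) ≤ x L k := by
  induction L using Nat.strong_induction_on generalizing k with
  | _ L ih =>
    have step : ∀ n, 1 ≤ n → n ≤ L → -a L k ≤ x n k →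
        (-∑ i ∈ Finset.range L, a (L - i) (i + k) ≤ x L k) := by
      intro n hn hnL hle
      obtain ⟨M, rfl⟩ := Nat.exists_eq_add_of_le hnL
      have h1 := ih M (by omega) (n + k)
      have h2 := hx k n M
      have h3 : ∑ i ∈ Finset.range M, a (n + M - (n + i)) (n + i + k)
          = ∑ i ∈ Finset.range M, a (M - i) (i + (n + k)) := by
        refine Finset.sum_congr rfl fun i _ => ?_
        congr 1 <;> omega
      have h4 : a (n + M) k ≤ ∑ i ∈ Finset.range n, a (n + M - i) (i + k) := by
        simpa using Finset.single_le_sum (f := fun i => a (n + M - i) (i + k))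
          (fun i _ => ha _ _) (Finset.mem_range.2 (show 0 < n by omega))
      rw [Finset.sum_range_add, h3]
      linarith
    rcases Nat.eq_zero_or_pos L with rfl | hL
    · simp [h0]
    rcases hcost L k hL with h | ⟨n, hn, hnL, h⟩
    · exact step 1 le_rfl hL (by linarith [neg_abs_le (x 1 k)])
    · exact step n hn hnL (by linarith [ha L k])

/-- An almost everywhere property holds along almost every orbit. -/
theorem ae_forall_iterate {Ω : Type*} [MeasurableSpace Ω] {μ : Measure Ω} {τ : Ω → Ω}
    (hτ : MeasurePreserving τ μ μ) {p : Ω → Prop} (hp : ∀ᵐ ω ∂μ, p ω) :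
    ∀ᵐ ω ∂μ, ∀ k : ℕ, p (τ^[k] ω) :=
  ae_all_iff.2 fun k => (hτ.iterate k).quasiMeasurePreserving.ae hp

theorem integral_comp_iterate {Ω : Type*} [MeasurableSpace Ω] {μ : Measure Ω} {τ : Ω → Ω}
    (hτ : MeasurePreserving τ μ μ) {f : Ω → ℝ} (hf : Integrable f μ) (k : ℕ) :
    ∫ ω, f (τ^[k] ω) ∂μ = ∫ ω, f ω ∂μ := by
  have hk := hτ.iterate k
  conv_rhs => rw [← hk.map_eq]
  exact (integral_map hk.aemeasurable (by rw [hk.map_eq]; exact hf.1)).symm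

theorem integrable_comp_iterate {Ω : Type*} [MeasurableSpace Ω] {μ : Measure Ω} {τ : Ω → Ω}
    (hτ : MeasurePreserving τ μ μ) {f : Ω → ℝ} (hf : Integrable f μ) (k : ℕ) :
    Integrable (fun ω => f (τ^[k] ω)) μ :=
  (hτ.iterate k).integrable_comp_of_integrable hf

theorem integrable_birkhoffSum {Ω : Type*} [MeasurableSpace Ω] {μ : Measure Ω} {τ : Ω → Ω}
    (hτ : MeasurePreserving τ μ μ) {f : Ω → ℝ} (hf : Integrable f μ) (n : ℕ) :
    Integrable (birkhoffSum τ f n) μ :=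
  integrable_finsetSum _ fun k _ => integrable_comp_iterate hτ hf k

theorem integral_birkhoffSum {Ω : Type*} [MeasurableSpace Ω] {μ : Measure Ω} {τ : Ω → Ω}
    (hτ : MeasurePreserving τ μ μ) {f : Ω → ℝ} (hf : Integrable f μ) (n : ℕ) :
    ∫ ω, birkhoffSum τ f n ω ∂μ = n * ∫ ω, f ω ∂μ := by
  simp only [birkhoffSum]
  rw [integral_finsetSum _ fun k _ => integrable_comp_iterate hτ hf k]
  simp [integral_comp_iterate hτ hf]

/-- Scheffé's lemma for nonnegative functions converging to a constant. -/
theorem tendsto_integral_abs_sub_const_of_nonneg {Ω : Type*} [MeasurableSpace Ω] {μ : Measure Ω}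
    [IsProbabilityMeasure μ] {f : ℕ → Ω → ℝ} {c : ℝ} (hf : ∀ n, Integrable (f n) μ)
    (h0 : ∀ n, ∀ᵐ ω ∂μ, 0 ≤ f n ω) (hlim : ∀ᵐ ω ∂μ, Tendsto (fun n => f n ω) atTop (𝓝 c))
    (hint : Tendsto (fun n => ∫ ω, f n ω ∂μ) atTop (𝓝 c)) :
    Tendsto (fun n => ∫ ω, |f n ω - c| ∂μ) atTop (𝓝 0) := by
  have hpos : Tendsto (fun n => ∫ ω, max (c - f n ω) 0 ∂μ) atTop (𝓝 (∫ _, (0 : ℝ) ∂μ)) := by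
    refine tendsto_integral_of_dominated_convergence (fun _ => |c|)
      (fun n => (((integrable_const c).sub (hf n)).pos_part).1) (integrable_const _) ?_ ?_
    · intro n
      filter_upwards [h0 n] with ω hω
      rw [Real.norm_of_nonneg (le_max_right _ _)]
      exact max_le (by linarith [le_abs_self c]) (abs_nonneg c)
    · filter_upwards [hlim] with ω hω
      simpa using ((tendsto_const_nhds (x := c)).sub hω).max (tendsto_const_nhds (x := (0 : ℝ)))
  have heq : ∀ n, ∫ ω, |f n ω - c| ∂μ
      = (∫ ω, f n ω ∂μ) - c + 2 * ∫ ω, max (c - f n ω) 0 ∂μ := by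
    intro n
    have hp : Integrable (fun ω => max (c - f n ω) 0) μ :=
      ((integrable_const (μ := μ) c).sub (hf n)).pos_part
    have hs : Integrable (fun ω => f n ω - c) μ := (hf n).sub (integrable_const c)
    have h1 : ∀ ω, |f n ω - c| = (f n ω - c) + 2 * max (c - f n ω) 0 := by
      intro ω
      rcases le_total c (f n ω) with h | h
      · rw [max_eq_right (by linarith), abs_of_nonneg (by linarith)]; ring
      · rw [max_eq_left (by linarith), abs_of_nonpos (by linarith)]; ring
    simp_rw [h1]
    rw [integral_add hs (hp.const_mul 2),
      integral_sub (hf n) (integrable_const c), integral_const_mul]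
    simp
  simp_rw [heq]
  simpa using (hint.sub_const c).add (hpos.const_mul 2)

theorem ae_tendsto_div_of_eventually_bounds {Ω : Type*} [MeasurableSpace Ω] {μ : Measure Ω}
    {ξ : ℕ → Ω → ℝ} {γ : ℝ}
    (hle : ∀ c, γ < c → ∀ᵐ ω ∂μ, ∀ᶠ n : ℕ in atTop, ξ n ω ≤ c * n)
    (hge : ∀ c, c < γ → ∀ᵐ ω ∂μ, ∀ᶠ n : ℕ in atTop, c * n ≤ ξ n ω) :
    ∀ᵐ ω ∂μ, Tendsto (fun n : ℕ => ξ n ω / n) atTop (𝓝 γ) := by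
  have h1 : ∀ᵐ ω ∂μ, ∀ q : ℚ, γ < q → ∀ᶠ n : ℕ in atTop, ξ n ω ≤ q * n :=
    ae_all_iff.2 fun q => eventually_imp_distrib_left.2 (hle q)
  have h2 : ∀ᵐ ω ∂μ, ∀ q : ℚ, q < γ → ∀ᶠ n : ℕ in atTop, q * n ≤ ξ n ω :=
    ae_all_iff.2 fun q => eventually_imp_distrib_left.2 (hge q)
  filter_upwards [h1, h2] with ω hω1 hω2
  refine tendsto_order.2 ⟨fun c hc => ?_, fun c hc => ?_⟩
  · obtain ⟨q, hcq, hq⟩ := exists_rat_btwn hc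
    filter_upwards [hω2 q hq, eventually_gt_atTop 0] with n hn hpos
    exact hcq.trans_le ((le_div_iff₀ (by exact_mod_cast hpos)).2 hn)
  · obtain ⟨q, hq, hqc⟩ := exists_rat_btwn hc
    filter_upwards [hω1 q hq, eventually_gt_atTop 0] with n hn hpos
    exact ((div_le_iff₀ (by exact_mod_cast hpos)).2 hn).trans_lt hqc

/-- For a nonnegative superadditive array, the values over all blocks of length `k` are controlled
by the value over one slightly longer block. -/
theorem sum_le_mul_of_nonneg_superadditive {x : ℕ → ℕ → ℝ} (h0 : ∀ n k, 0 ≤ x n k)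
    (hx : ∀ k m n, x m k + x n (m + k) ≤ x (m + n) k) {k : ℕ} (hk : 1 ≤ k) (n : ℕ) :
    ∑ i ∈ Finset.range n, x k i ≤ k * x (n + 2 * k) 0 := by
  have hblock : ∀ q s, ∑ i ∈ Finset.range (q * k), x k (i + s)
      ≤ ∑ j ∈ Finset.range k, x (q * k) (j + s) := by
    intro q
    induction q with
    | zero => intro s; simpa using Finset.sum_nonneg fun j _ => h0 0 (j + s)
    | succ q ih =>
      intro s
      rw [Nat.succ_mul, add_comm, Finset.sum_range_add]
      have h1 := ih (k + s)
      have h2 : ∑ i ∈ Finset.range (q * k), x k (k + i + s)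
          = ∑ i ∈ Finset.range (q * k), x k (i + (k + s)) :=
        Finset.sum_congr rfl fun i _ => by congr 1; omega
      have h3 : ∑ j ∈ Finset.range k, x k (j + s)
          + ∑ j ∈ Finset.range k, x (q * k) (j + (k + s))
          ≤ ∑ j ∈ Finset.range k, x (k + q * k) (j + s) := by
        rw [← Finset.sum_add_distrib]
        refine Finset.sum_le_sum fun j _ => ?_
        have := hx (j + s) k (q * k)
        rwa [show k + (j + s) = j + (k + s) by omega] at this
      linarith
  set q := n / k + 1 with hq
  have hnq : n ≤ q * k := (Nat.lt_div_mul_add hk).le.trans_eq (by rw [hq]; ring)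
  have hqn : q * k ≤ n + k := by
    have := Nat.div_mul_le_self n k
    rw [hq, add_mul, one_mul]
    omega
  calc ∑ i ∈ Finset.range n, x k i
      ≤ ∑ i ∈ Finset.range (q * k), x k i :=
        Finset.sum_le_sum_of_subset_of_nonneg (Finset.range_mono hnq) fun i _ _ => h0 _ _
    _ ≤ ∑ j ∈ Finset.range k, x (q * k) j := by simpa using hblock q 0
    _ ≤ ∑ j ∈ Finset.range k, x (n + 2 * k) 0 := by
        refine Finset.sum_le_sum fun j hj => ?_
        have hj' := Finset.mem_range.1 hj
        obtain ⟨r, hr⟩ := Nat.exists_eq_add_of_le (show j + q * k ≤ n + 2 * k by omega)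
        have h1 := hx 0 j (q * k)
        have h2 := hx 0 (j + q * k) r
        rw [hr]
        simp only [add_zero] at h1 h2
        linarith [h0 j 0, h0 r (j + q * k)]
    _ = k * x (n + 2 * k) 0 := by simp

namespace IsSuperadditiveProcess

variable {Ω : Type*} [MeasurableSpace Ω] {μ : Measure Ω} {τ : Ω → Ω} {ξ ζ : ℕ → Ω → ℝ}

theorem add (hξ : IsSuperadditiveProcess μ τ ξ) (hζ : IsSuperadditiveProcess μ τ ζ) :
    IsSuperadditiveProcess μ τ (fun n ω => ξ n ω + ζ n ω) where
  zero ω := by simp [hξ.zero, hζ.zero]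
  integrable n := (hξ.integrable n).add (hζ.integrable n)
  superadd m n := by
    filter_upwards [hξ.superadd m n, hζ.superadd m n] with ω h1 h2
    linarith

theorem of_birkhoffSum (hτ : MeasurePreserving τ μ μ) {f : Ω → ℝ} (hf : Integrable f μ) :
    IsSuperadditiveProcess μ τ (birkhoffSum τ f) where
  zero ω := by simp
  integrable n := integrable_birkhoffSum hτ hf n
  superadd m n := ae_of_all _ fun ω => (birkhoffSum_add τ f m n ω).ge

theorem sub_const_mul [IsFiniteMeasure μ] (hξ : IsSuperadditiveProcess μ τ ξ) (c : ℝ) :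
    IsSuperadditiveProcess μ τ (fun n ω => ξ n ω - c * n) where
  zero ω := by simp [hξ.zero]
  integrable n := (hξ.integrable n).sub (integrable_const _)
  superadd m n := by
    filter_upwards [hξ.superadd m n] with ω h
    push_cast
    linarith

theorem ae_superadd_orbit (hξ : IsSuperadditiveProcess μ τ ξ) (hτ : MeasurePreserving τ μ μ) :
    ∀ᵐ ω ∂μ, ∀ k m n, ξ m (τ^[k] ω) + ξ n (τ^[m + k] ω) ≤ ξ (m + n) (τ^[k] ω) := by
  have h : ∀ᵐ ω ∂μ, ∀ m n, ξ m ω + ξ n (τ^[m] ω) ≤ ξ (m + n) ω :=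
    ae_all_iff.2 fun m => ae_all_iff.2 fun n => hξ.superadd m n
  filter_upwards [ae_forall_iterate hτ h] with ω hω k m n
  rw [Function.iterate_add_apply]
  exact hω k m n

theorem integral_superadd (hξ : IsSuperadditiveProcess μ τ ξ) (hτ : MeasurePreserving τ μ μ)
    (m n : ℕ) : (∫ ω, ξ m ω ∂μ) + ∫ ω, ξ n ω ∂μ ≤ ∫ ω, ξ (m + n) ω ∂μ := by
  have hn := integrable_comp_iterate hτ (hξ.integrable n) m
  rw [← integral_comp_iterate hτ (hξ.integrable n) m, ← integral_add (hξ.integrable m) hn]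
  exact integral_mono_ae ((hξ.integrable m).add hn) (hξ.integrable _) (hξ.superadd m n)

/-- A maximal inequality: a superadditive process which almost surely becomes nonnegative at some
positive time has nonnegative growth rate. -/
theorem nonneg_of_ae_exists_nonneg (hξ : IsSuperadditiveProcess μ τ ξ)
    (hτ : MeasurePreserving τ μ μ) {γ : ℝ} (hγ : ∀ n, ∫ ω, ξ n ω ∂μ ≤ γ * n)
    (hex : ∀ᵐ ω ∂μ, ∃ n, 1 ≤ n ∧ 0 ≤ ξ n ω) : 0 ≤ γ := by
  set h : Ω → ℝ := fun ω => |ξ 1 ω| with hh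
  have hhint : Integrable h μ := (hξ.integrable 1).abs
  set B : ℕ → Set Ω := fun N => ⋂ n, ⋂ (_ : 1 ≤ n ∧ n ≤ N), {ω | ξ n ω < 0} with hB
  have hBm : ∀ N, NullMeasurableSet (B N) μ := fun N =>
    .iInter fun n => .iInter fun _ => (hξ.integrable n).1.nullMeasurableSet_lt
      aestronglyMeasurable_const
  have hmem : ∀ N ω, ω ∉ B N → ∃ n, 1 ≤ n ∧ n ≤ N ∧ 0 ≤ ξ n ω := by
    intro N ω hω
    simpa [hB, and_assoc] using hω
  have hgint : ∀ N, Integrable ((B N).indicator h) μ := fun N => hhint.indicator₀ (hBm N)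
  have hbound : ∀ N, -γ ≤ ∫ ω, (B N).indicator h ω ∂μ := by
    intro N
    set a : ℕ → Ω → ℝ := fun j => if j ≤ N then h else (B N).indicator h with ha
    have haint : ∀ j, Integrable (a j) μ := by
      intro j
      simp only [ha]
      split_ifs
      · exact hhint
      · exact hgint N
    have ha0 : ∀ j ω, 0 ≤ a j ω := by
      intro j ω
      simp only [ha]
      split_ifs
      · exact abs_nonneg _
      · exact Set.indicator_nonneg (fun _ _ => abs_nonneg _) _
    have hsum : ∀ L : ℕ, -∑ j ∈ Finset.range L, ∫ ω, a (j + 1) ω ∂μ ≤ γ * L := by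
      intro L
      refine le_trans ?_ (hγ L)
      have hae : ∀ᵐ ω ∂μ, -∑ i ∈ Finset.range L, a (L - i) (τ^[i] ω) ≤ ξ L ω := by
        filter_upwards [hξ.ae_superadd_orbit hτ] with ω hω
        have := neg_sum_cost_le_of_superadditive (x := fun n k => ξ n (τ^[k] ω))
          (a := fun j k => a j (τ^[k] ω)) (fun k => hξ.zero _) hω (fun j k => ha0 _ _) ?_ L 0
        · simpa using this
        · intro j k hj
          by_cases hjN : j ≤ N
          · left; simp [ha, hjN, hh]
          by_cases hmB : τ^[k] ω ∈ B N
          · left; simp [ha, hjN, hmB, hh]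
          · right
            obtain ⟨n, h1, h2, h3⟩ := hmem _ _ hmB
            exact ⟨n, h1, by omega, h3⟩
      have hi : ∀ i ∈ Finset.range L, Integrable (fun ω => a (L - i) (τ^[i] ω)) μ :=
        fun i _ => integrable_comp_iterate hτ (haint _) i
      have h1 := integral_mono_ae (integrable_finsetSum _ hi).neg (hξ.integrable L) hae
      refine le_trans (le_of_eq ?_) h1
      simp only [Pi.neg_apply]
      rw [integral_neg, integral_finsetSum _ hi, ← Finset.sum_range_reflect]
      congr 1
      refine Finset.sum_congr rfl fun i hi' => ?_
      rw [integral_comp_iterate hτ (haint _)]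
      have : L - 1 - i + 1 = L - i := by have := Finset.mem_range.1 hi'; omega
      rw [this]
    have hces : Tendsto (fun L : ℕ => (L : ℝ)⁻¹ * ∑ j ∈ Finset.range L, ∫ ω, a (j + 1) ω ∂μ)
        atTop (𝓝 (∫ ω, (B N).indicator h ω ∂μ)) := by
      refine Filter.Tendsto.cesaro (tendsto_const_nhds.congr' ?_)
      filter_upwards [eventually_ge_atTop N] with j hj
      simp [ha, show ¬ (j + 1 ≤ N) by omega]
    refine ge_of_tendsto hces ?_
    filter_upwards [eventually_gt_atTop 0] with L hL
    have hL' : (0 : ℝ) < L := by exact_mod_cast hL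
    rw [inv_mul_eq_div, le_div_iff₀ hL']
    linarith [hsum L]
  have hlim : Tendsto (fun N => ∫ ω, (B N).indicator h ω ∂μ) atTop (𝓝 (∫ _, (0 : ℝ) ∂μ)) := by
    refine tendsto_integral_of_dominated_convergence h (fun N => (hgint N).1) hhint ?_ ?_
    · intro N
      refine ae_of_all _ fun ω => ?_
      refine (norm_indicator_le_norm_self h ω).trans ?_
      simp [hh]
    · filter_upwards [hex] with ω ⟨n, hn, hω⟩
      refine tendsto_const_nhds.congr' ?_
      filter_upwards [eventually_ge_atTop n] with N hN
      refine (Set.indicator_of_notMem ?_ _).symm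
      intro hmem'
      have := Set.mem_iInter₂.1 hmem' n ⟨hn, hN⟩
      exact absurd this (not_lt.2 hω)
  have := ge_of_tendsto' hlim hbound
  simp at this
  linarith

theorem ae_eventually_le_of_neg [IsProbabilityMeasure μ] (hξ : IsSuperadditiveProcess μ τ ξ)
    (herg : Ergodic τ μ) {γ : ℝ} (hγ : ∀ n, ∫ ω, ξ n ω ∂μ ≤ γ * n) (hneg : γ < 0) {ε : ℝ}
    (hε : 0 < ε) : ∀ᵐ ω ∂μ, ∀ᶠ n : ℕ in atTop, ξ n ω ≤ ε * n := by
  have hτ := herg.toMeasurePreserving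
  set E : Set Ω := ⋃ k : ℕ, ⋂ a : ℕ, ⋃ n : ℕ, ⋃ (_ : a ≤ n), {ω | (1 / (k + 1 : ℝ)) * n < ξ n ω}
    with hE
  have hmem : ∀ ω, ω ∈ E ↔ ∃ k : ℕ, ∃ᶠ n : ℕ in atTop, (1 / (k + 1 : ℝ)) * n < ξ n ω := by
    intro ω
    simp [hE, frequently_atTop]
  have hEm : NullMeasurableSet E μ :=
    .iUnion fun k => .iInter fun a => .iUnion fun n => .iUnion fun _ =>
      aestronglyMeasurable_const.nullMeasurableSet_lt (hξ.integrable n).1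
  have hinv : τ ⁻¹' E ≤ᵐ[μ] E := by
    filter_upwards [hξ.ae_superadd_orbit hτ] with ω hω hωE
    change ω ∈ E
    obtain ⟨k, hk⟩ := (hmem _).1 hωE
    refine (hmem _).2 ⟨k + 1, ?_⟩
    have hδ : (0 : ℝ) < 1 / (k + 1) - 1 / (k + 1 + 1) := by
      rw [sub_pos]; exact one_div_lt_one_div_of_lt (by positivity) (by linarith)
    have hev : ∀ᶠ n : ℕ in atTop,
        1 / (k + 1 + 1 : ℝ) - ξ 1 ω ≤ (1 / (k + 1) - 1 / (k + 1 + 1) : ℝ) * n :=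
      (tendsto_natCast_atTop_atTop.const_mul_atTop hδ).eventually_ge_atTop _
    refine (tendsto_add_atTop_nat 1).frequently ((hk.and_eventually hev).mono ?_)
    rintro n ⟨h1, h2⟩
    have h3 := hω 0 1 n
    simp only [Function.iterate_zero, id, add_zero, Function.iterate_one] at h3
    rw [add_comm 1 n] at h3
    push_cast
    nlinarith
  rcases herg.ae_empty_or_univ_of_preimage_ae_le hEm hinv with h | h
  · filter_upwards [h.mem_iff] with ω hω
    have hω' : ω ∉ E := fun hc => by simpa using hω.1 hc
    obtain ⟨k, hk⟩ := exists_nat_one_div_lt hε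
    have h1 : ¬ ∃ᶠ n : ℕ in atTop, (1 / (k + 1 : ℝ)) * n < ξ n ω :=
      fun hc => hω' ((hmem ω).2 ⟨k, hc⟩)
    filter_upwards [not_frequently.1 h1] with n hn
    exact (not_lt.1 hn).trans (mul_le_mul_of_nonneg_right hk.le n.cast_nonneg)
  · refine absurd (hξ.nonneg_of_ae_exists_nonneg hτ hγ ?_) (not_le.2 hneg)
    filter_upwards [h.mem_iff] with ω hω
    obtain ⟨k, hk⟩ := (hmem ω).1 (hω.2 trivial)
    obtain ⟨n, hn, h1⟩ := frequently_atTop.1 hk 1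
    exact ⟨n, hn, le_trans (by positivity) h1.le⟩

theorem ae_eventually_le [IsProbabilityMeasure μ] (hξ : IsSuperadditiveProcess μ τ ξ)
    (herg : Ergodic τ μ) {γ : ℝ} (hγ : ∀ n, ∫ ω, ξ n ω ∂μ ≤ γ * n) {c : ℝ}
    (hc : γ < c) : ∀ᵐ ω ∂μ, ∀ᶠ n : ℕ in atTop, ξ n ω ≤ c * n := by
  have h := (hξ.sub_const_mul ((γ + c) / 2)).ae_eventually_le_of_neg herg
    (γ := γ - (γ + c) / 2) (ε := (c - γ) / 2) ?_ (by linarith) (by linarith)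
  · filter_upwards [h] with ω hω
    filter_upwards [hω] with n hn
    linarith
  · intro n
    rw [integral_sub (hξ.integrable n) (integrable_const _)]
    simp only [integral_const, probReal_univ, one_smul]
    linarith [hγ n]

/-- **Birkhoff's pointwise ergodic theorem** for an ergodic probability-preserving map. -/
theorem _root_.Ergodic.ae_tendsto_birkhoffSum_div [IsProbabilityMeasure μ] (herg : Ergodic τ μ)
    {f : Ω → ℝ} (hf : Integrable f μ) :
    ∀ᵐ ω ∂μ, Tendsto (fun n : ℕ => birkhoffSum τ f n ω / n) atTop
      (𝓝 (∫ ω, f ω ∂μ)) := by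
  have hτ := herg.toMeasurePreserving
  refine ae_tendsto_div_of_eventually_bounds (fun c hc => ?_) fun c hc => ?_
  · refine (of_birkhoffSum hτ hf).ae_eventually_le herg (fun n => ?_) hc
    rw [integral_birkhoffSum hτ hf, mul_comm]
  · have h := (of_birkhoffSum hτ hf.neg).ae_eventually_le herg (γ := -∫ ω, f ω ∂μ) (c := -c)
      (fun n => ?_) (by linarith)
    · filter_upwards [h] with ω hω
      filter_upwards [hω] with n hn
      rw [birkhoffSum_neg] at hn
      linarith
    · rw [integral_birkhoffSum hτ hf.neg, mul_comm]
      simp [integral_neg]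

theorem ae_tendsto_of_nonneg [IsProbabilityMeasure μ] (hξ : IsSuperadditiveProcess μ τ ξ)
    (herg : Ergodic τ μ) (h0 : ∀ᵐ ω ∂μ, ∀ n, 0 ≤ ξ n ω) {γ : ℝ}
    (hγ : ∀ n, ∫ ω, ξ n ω ∂μ ≤ γ * n)
    (hlim : Tendsto (fun n : ℕ => (∫ ω, ξ n ω ∂μ) / n) atTop (𝓝 γ)) :
    ∀ᵐ ω ∂μ, Tendsto (fun n : ℕ => ξ n ω / n) atTop (𝓝 γ) := by
  have hτ := herg.toMeasurePreserving
  refine ae_tendsto_div_of_eventually_bounds (fun c hc => hξ.ae_eventually_le herg hγ hc)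
    fun c hc => ?_
  obtain ⟨k, hck, hk⟩ := ((hlim.eventually_const_lt hc).and (eventually_ge_atTop 1)).exists
  have hk0 : (0 : ℝ) < k := by exact_mod_cast hk
  rw [lt_div_iff₀ hk0] at hck
  filter_upwards [hξ.ae_superadd_orbit hτ, ae_forall_iterate hτ h0,
    herg.ae_tendsto_birkhoffSum_div (hξ.integrable k)] with ω hsup hnn hB
  have h1 : ∀ n, birkhoffSum τ (ξ k) n ω ≤ k * ξ (n + 2 * k) ω := fun n =>
    sum_le_mul_of_nonneg_superadditive (x := fun n k => ξ n (τ^[k] ω))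
      (fun n k => hnn k n) hsup hk n
  have h2 : Tendsto (fun n : ℕ => birkhoffSum τ (ξ k) n ω / n * (n / (n + (2 * k : ℝ))))
      atTop (𝓝 (∫ ω, ξ k ω ∂μ)) := by
    simpa using hB.mul (tendsto_natCast_div_add_atTop (2 * k : ℝ))
  rw [← map_add_atTop_eq_nat (2 * k), eventually_map]
  filter_upwards [h2.eventually_const_lt hck, eventually_gt_atTop 0] with n hn hpos
  have hn0 : (0 : ℝ) < n := by exact_mod_cast hpos
  rw [div_mul_div_cancel₀ hn0.ne', lt_div_iff₀ (by positivity)] at hn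
  have h3 := h1 n
  push_cast
  refine le_of_mul_le_mul_left ?_ hk0
  linarith

theorem tendsto_integral_abs_of_nonneg [IsProbabilityMeasure μ]
    (hξ : IsSuperadditiveProcess μ τ ξ) (herg : Ergodic τ μ) (h0 : ∀ᵐ ω ∂μ, ∀ n, 0 ≤ ξ n ω)
    {γ : ℝ} (hγ : ∀ n, ∫ ω, ξ n ω ∂μ ≤ γ * n)
    (hlim : Tendsto (fun n : ℕ => (∫ ω, ξ n ω ∂μ) / n) atTop (𝓝 γ)) :
    Tendsto (fun n : ℕ => ∫ ω, |ξ n ω / n - γ| ∂μ) atTop (𝓝 0) := by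
  refine tendsto_integral_abs_sub_const_of_nonneg (fun n => (hξ.integrable n).div_const _)
    (fun n => ?_) (hξ.ae_tendsto_of_nonneg herg h0 hγ hlim) ?_
  · filter_upwards [h0] with ω hω
    exact div_nonneg (hω n) n.cast_nonneg
  · simpa only [integral_div] using hlim

/-- Fekete's lemma for the expectations of a superadditive process. -/
theorem integral_le_and_tendsto (hξ : IsSuperadditiveProcess μ τ ξ)
    (hτ : MeasurePreserving τ μ μ) {A : ℝ} (hA : 0 ≤ A)
    (hbd : ∀ n, 1 ≤ n → ∫ ω, ξ n ω ∂μ ≤ A * n) :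
    (∀ n, ∫ ω, ξ n ω ∂μ ≤ (⨆ m : {m : ℕ // 1 ≤ m}, (∫ ω, ξ m.1 ω ∂μ) / m.1) * n) ∧
    Tendsto (fun n : ℕ => (∫ ω, ξ n ω ∂μ) / n) atTop
      (𝓝 (⨆ m : {m : ℕ // 1 ≤ m}, (∫ ω, ξ m.1 ω ∂μ) / m.1)) := by
  have hdiv : ∀ n : ℕ, (∫ ω, ξ n ω ∂μ) / n ≤ A := by
    intro n
    rcases Nat.eq_zero_or_pos n with rfl | hn
    · simpa using hA
    · exact (div_le_iff₀ (by exact_mod_cast hn)).2 (hbd n hn)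
  have hbdd : BddAbove (Set.range fun m : {m : ℕ // 1 ≤ m} => (∫ ω, ξ m.1 ω ∂μ) / m.1) :=
    ⟨A, by rintro _ ⟨m, rfl⟩; exact hdiv m⟩
  refine ⟨fun n => ?_, ?_⟩
  · rcases Nat.eq_zero_or_pos n with rfl | hn
    · simp [hξ.zero]
    · exact (div_le_iff₀ (by exact_mod_cast hn)).1 (le_ciSup hbdd ⟨n, hn⟩)
  · have hsub : Subadditive fun n => -∫ ω, ξ n ω ∂μ := fun m n => by
      linarith [hξ.integral_superadd hτ m n]
    have ht := (hsub.tendsto_lim ⟨-A, by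
      rintro _ ⟨n, rfl⟩
      simpa [neg_div] using hdiv n⟩).neg
    have hl : -hsub.lim = ⨆ m : {m : ℕ // 1 ≤ m}, (∫ ω, ξ m.1 ω ∂μ) / m.1 := by
      have himg : (fun n : ℕ => (-∫ ω, ξ n ω ∂μ) / n) '' Set.Ici 1
          = -Set.range fun m : {m : ℕ // 1 ≤ m} => (∫ ω, ξ m.1 ω ∂μ) / m.1 := by
        ext x
        simp [neg_div, neg_eq_iff_eq_neg]
      rw [Subadditive.lim, himg, Real.sInf_neg, neg_neg, iSup]
    simpa [hl, neg_div] using ht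

theorem nonneg_add_birkhoffSum (hξ : IsSuperadditiveProcess μ τ ξ)
    (hτ : MeasurePreserving τ μ μ) :
    ∀ᵐ ω ∂μ, ∀ n, 0 ≤ ξ n ω + birkhoffSum τ (fun ω => max (-ξ 1 ω) 0) n ω := by
  filter_upwards [hξ.ae_superadd_orbit hτ] with ω hω n
  suffices ∀ k, 0 ≤ ξ n (τ^[k] ω)
      + birkhoffSum τ (fun ω => max (-ξ 1 ω) 0) n (τ^[k] ω) by simpa using this 0
  induction n with
  | zero => intro k; simp [hξ.zero]
  | succ n ih =>
    intro k
    have h1 := hω k 1 n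
    have h2 := ih (1 + k)
    rw [add_comm 1 k, Function.iterate_succ_apply'] at h1 h2
    rw [birkhoffSum_succ', add_comm n 1]
    linarith [le_max_left (-ξ 1 (τ^[k] ω)) 0]

/-- **Kingman's ergodic theorem** for an ergodic superadditive process. -/
theorem ae_tendsto_and_tendsto_integral_abs [IsProbabilityMeasure μ]
    (hξ : IsSuperadditiveProcess μ τ ξ) (herg : Ergodic τ μ) {γ : ℝ}
    (hγ : ∀ n, ∫ ω, ξ n ω ∂μ ≤ γ * n)
    (hlim : Tendsto (fun n : ℕ => (∫ ω, ξ n ω ∂μ) / n) atTop (𝓝 γ)) :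
    (∀ᵐ ω ∂μ, Tendsto (fun n : ℕ => ξ n ω / n) atTop (𝓝 γ)) ∧
    Tendsto (fun n : ℕ => ∫ ω, |ξ n ω / n - γ| ∂μ) atTop (𝓝 0) := by
  have hτ := herg.toMeasurePreserving
  set g : Ω → ℝ := fun ω => max (-ξ 1 ω) 0 with hg
  have hgi : Integrable g μ := (hξ.integrable 1).neg_part
  set G := ∫ ω, g ω ∂μ with hG
  have hS := of_birkhoffSum hτ hgi
  have hζ := hξ.add hS
  have hS0 : ∀ᵐ ω ∂μ, ∀ n, 0 ≤ birkhoffSum τ g n ω :=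
    ae_of_all _ fun ω n => Finset.sum_nonneg fun i _ => le_max_right _ _
  have hSi : ∀ n : ℕ, ∫ ω, birkhoffSum τ g n ω ∂μ = G * n := fun n => by
    rw [integral_birkhoffSum hτ hgi, mul_comm]
  have hζi : ∀ n : ℕ, ∫ ω, ξ n ω + birkhoffSum τ g n ω ∂μ
      = (∫ ω, ξ n ω ∂μ) + G * n := fun n => by
    rw [integral_add (hξ.integrable n) (hS.integrable n), hSi]
  have hSlim : Tendsto (fun n : ℕ => (∫ ω, birkhoffSum τ g n ω ∂μ) / n) atTop (𝓝 G) := by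
    refine tendsto_const_nhds.congr' ?_
    filter_upwards [eventually_ne_atTop 0] with n hn
    rw [hSi, mul_div_cancel_right₀ _ (Nat.cast_ne_zero.2 hn)]
  have hζγ : ∀ n : ℕ, ∫ ω, ξ n ω + birkhoffSum τ g n ω ∂μ ≤ (γ + G) * n := fun n => by
    rw [hζi]
    linarith [hγ n]
  have hζlim : Tendsto (fun n : ℕ => (∫ ω, ξ n ω + birkhoffSum τ g n ω ∂μ) / n) atTop
      (𝓝 (γ + G)) := by
    refine (hlim.add hSlim).congr fun n => ?_
    rw [hζi, hSi, add_div]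
  have hζ0 := hξ.nonneg_add_birkhoffSum hτ
  constructor
  · filter_upwards [hζ.ae_tendsto_of_nonneg herg hζ0 hζγ hζlim,
      herg.ae_tendsto_birkhoffSum_div hgi] with ω h1 h2
    have h3 := h1.sub h2
    rw [add_sub_cancel_right] at h3
    refine h3.congr fun n => ?_
    ring
  · have h1 := (hζ.tendsto_integral_abs_of_nonneg herg hζ0 hζγ hζlim).add
      (hS.tendsto_integral_abs_of_nonneg herg hS0 (fun n => (hSi n).le) hSlim)
    rw [add_zero] at h1
    refine squeeze_zero (fun n => integral_nonneg fun ω => abs_nonneg _) (fun n => ?_) h1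
    have i1 : Integrable (fun ω => |(ξ n ω + birkhoffSum τ g n ω) / n - (γ + G)|) μ :=
      (((hζ.integrable n).div_const _).sub (integrable_const _)).abs
    have i2 : Integrable (fun ω => |birkhoffSum τ g n ω / n - G|) μ :=
      (((hS.integrable n).div_const _).sub (integrable_const _)).abs
    rw [← integral_add i1 i2]
    refine integral_mono ((((hξ.integrable n).div_const _).sub (integrable_const _)).abs)
      (i1.add i2) fun ω => ?_
    refine le_trans (le_of_eq ?_) (abs_sub _ _)
    congr 1
    ring

end IsSuperadditiveProcess

/-- **Superadditive ergodic theorem** (Bellissard et al. version).  Let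
`(ξ_n)` be an integrable superadditive process, `ξ_{m+n} ≥ ξ_m + ξ_n ∘ τ^m`
a.s., with respect to a measure-preserving shift `τ` whose invariant
`σ`-algebra is trivial (ergodicity, as holds for the shift on an i.i.d.
sequence), and suppose `E(ξ_n) ≤ A n` for some constant `A > 0`.  Then
`ξ_n / n` converges almost surely and in the mean to the constant
`γ = sup_n E(ξ_n)/n`. -/
theorem superadditive_ergodic
    {Ω : Type*} [MeasurableSpace Ω] (μ : Measure Ω) [IsProbabilityMeasure μ]
    (τ : Ω → Ω) (hτ : MeasurePreserving τ μ μ) (herg : Ergodic τ μ)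
    (ξ : ℕ → Ω → ℝ) (hint : ∀ n, Integrable (ξ n) μ)
    (hsup : ∀ m n, 1 ≤ m → 1 ≤ n →
      ∀ᵐ ω ∂μ, ξ m ω + ξ n (τ^[m] ω) ≤ ξ (m + n) ω)
    (A : ℝ) (hA : 0 < A)
    (hbd : ∀ n, 1 ≤ n → (∫ ω, ξ n ω ∂μ) ≤ A * n) :
    (∀ᵐ ω ∂μ, Tendsto (fun n : ℕ => ξ n ω / n) atTop
      (𝓝 (⨆ n : {n : ℕ // 1 ≤ n}, (∫ ω', ξ n.1 ω' ∂μ) / n.1))) ∧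
    Tendsto (fun n : ℕ =>
        ∫ ω, |ξ n ω / n - ⨆ m : {m : ℕ // 1 ≤ m}, (∫ ω', ξ m.1 ω' ∂μ) / m.1| ∂μ)
      atTop (𝓝 0) := by
  set ζ : ℕ → Ω → ℝ := fun n ω => if n = 0 then 0 else ξ n ω with hζdef
  have hζξ : ∀ n, 1 ≤ n → ζ n = ξ n := fun n hn => by
    simp [hζdef, show n ≠ 0 by omega]
  have hζ : IsSuperadditiveProcess μ τ ζ := by
    refine ⟨fun ω => by simp [hζdef], fun n => ?_, fun m n => ?_⟩
    · rcases Nat.eq_zero_or_pos n with rfl | hn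
      · simp [hζdef]
      · rw [hζξ n hn]; exact hint n
    · rcases Nat.eq_zero_or_pos m with rfl | hm
      · simp [hζdef]
      rcases Nat.eq_zero_or_pos n with rfl | hn
      · simp [hζdef]
      rw [hζξ m hm, hζξ n hn, hζξ (m + n) (by omega)]
      exact hsup m n hm hn
  obtain ⟨h1, h2⟩ := hζ.integral_le_and_tendsto hτ hA.le fun n hn => by
    rw [hζξ n hn]; exact hbd n hn
  have hγ : (⨆ m : {m : ℕ // 1 ≤ m}, (∫ ω, ζ m.1 ω ∂μ) / m.1)
      = ⨆ m : {m : ℕ // 1 ≤ m}, (∫ ω, ξ m.1 ω ∂μ) / m.1 :=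
    iSup_congr fun m => by rw [hζξ m.1 m.2]
  rw [hγ] at h1 h2
  obtain ⟨h3, h4⟩ := hζ.ae_tendsto_and_tendsto_integral_abs herg h1 h2
  refine ⟨?_, h4.congr' ?_⟩
  · filter_upwards [h3] with ω hω
    refine hω.congr' ?_
    filter_upwards [eventually_ge_atTop 1] with n hn
    rw [hζξ n hn]
  · filter_upwards [eventually_ge_atTop 1] with n hn
    rw [hζξ n hn]
end
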